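/- Let t be an even positive integer and let v₁, …, v_t ∈ 𝔽₂^t be vectors satisfying vᵢ · vᵢ = 0 for all i and vᵢ · vⱼ = 1 for all i ≠ j (scalar products over 𝔽₂). Then the vectors v₁, …, v_t are linearly independent over 𝔽₂. In particular, they are pairwise distinct. -/

import Mathlib

/-- Oddtown-type claim: if `t` is even and positive and `v₁, …, v_t ∈ 𝔽₂^t` satisfy
`vᵢ ⬝ vᵢ = 0` for all `i` and `vᵢ ⬝ vⱼ = 1` for all `i ≠ j`, then `v₁, …, v_t` are
linearly independent over `𝔽₂`; in particular, they are pairwise distinct. -/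
theorem oddtown_linear_independent (t : ℕ) (ht : 0 < t) (htEven : Even t)
    (v : Fin t → (Fin t → ZMod 2))
    (hself : ∀ i, ∑ k, v i k * v i k = 0)
    (hcross : ∀ i j, i ≠ j → ∑ k, v i k * v j k = 1) :
    LinearIndependent (ZMod 2) v ∧ Function.Injective v := by
  have hli : LinearIndependent (ZMod 2) v := by
    rw [Fintype.linearIndependent_iff]
    intro g hg
    have coeff_eq_sum : ∀ j, g j = ∑ i, g i := by
      intro j
      have hdot : ∑ i, g i * ∑ k, v i k * v j k = 0 := by
        calc ∑ i, g i * ∑ k, v i k * v j k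
            = ∑ k, (∑ i, g i • v i) k * v j k := by
              simp only [Finset.mul_sum, Finset.sum_apply, Pi.smul_apply, smul_eq_mul,
                Finset.sum_mul, mul_assoc]
              exact Finset.sum_comm
          _ = 0 := by rw [hg]; simp
      have hgram : ∀ i, g i * ∑ k, v i k * v j k = g i - if i = j then g i else 0 := by
        intro i
        by_cases h : i = j
        · subst h
          simp [hself]
        · simp [hcross i j h, h]
      simp only [hgram, Finset.sum_sub_distrib, Finset.sum_ite_eq', Finset.mem_univ,
        if_true] at hdot
      exact (sub_eq_zero.mp hdot).symm
    have sum_eq_zero : ∑ i, g i = 0 := by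
      have hcast : (t : ZMod 2) = 0 := (ZMod.natCast_eq_zero_iff_even).mpr htEven
      rw [Finset.sum_congr rfl fun j _ => coeff_eq_sum j]
      simp [hcast]
    exact fun j => (coeff_eq_sum j).trans sum_eq_zero
  exact ⟨hli, hli.injective⟩
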